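/- arXiv:2511.00452 — 7 statements merged into one kernel-verified Lean document; each statement's English description precedes it below -/
import Mathlib

section
/- Let X ⊆ ℝⁿ be a compact set, f : ℝⁿ → ℝ be upper semicontinuous on X, and let f̂ denote the concave envelope of f over conv(X). Then for every x ∈ conv(X) there exist an integer K with 1 ≤ K ≤ n+1, points x¹, …, x^K ∈ X, and coefficients λ₁, …, λ_K > 0 with λ₁ + ⋯ + λ_K = 1, such that x = λ₁x¹ + ⋯ + λ_K x^K and f̂(x) = λ₁f(x¹) + ⋯ + λ_K f(x^K). -/
open Finset

/-- The concave envelope of `f` over `conv(X)`: for `x`,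
`f̂(x) = sup { ∑ λ_k f(x^k) : λ ∈ Δ_n, x^k ∈ X, ∑ λ_k x^k = x }`. -/
noncomputable def concaveEnvelope {n : ℕ} (X : Set (Fin n → ℝ)) (f : (Fin n → ℝ) → ℝ)
    (x : Fin n → ℝ) : ℝ :=
  sSup { s : ℝ | ∃ (lam : Fin (n + 1) → ℝ) (xs : Fin (n + 1) → Fin n → ℝ),
    (∀ k, 0 ≤ lam k) ∧ (∑ k, lam k = 1) ∧ (∀ k, xs k ∈ X) ∧
    (∑ k, lam k • xs k = x) ∧ s = ∑ k, lam k * f (xs k) }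

/-- The product of a nonnegative coordinate and an upper semicontinuous function of the other
coordinate is upper semicontinuous; no bound from below is needed. -/
theorem UpperSemicontinuousOn.continuous_mul_comp {α β : Type*} [TopologicalSpace α]
    [TopologicalSpace β] {X : Set β} {f : β → ℝ} (hf : UpperSemicontinuousOn f X)
    {s : Set α} {g : α → ℝ} {u : α → β} (hg : ContinuousOn g s) (hu : ContinuousOn u s)
    (hg0 : ∀ a ∈ s, 0 ≤ g a) (hus : Set.MapsTo u s X) :
    UpperSemicontinuousOn (fun a => g a * f (u a)) s := by
  intro a ha y hy
  obtain ⟨c, hc, hcy⟩ : ∃ c, f (u a) < c ∧ g a * c < y := by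
    have hcont : Filter.Tendsto (fun c => g a * c) (nhdsWithin (f (u a)) (Set.Ioi (f (u a))))
        (nhds (g a * f (u a))) :=
      ((continuous_const.mul continuous_id).tendsto _).mono_left nhdsWithin_le_nhds
    have h := (hcont.eventually (gt_mem_nhds hy)).and self_mem_nhdsWithin
    obtain ⟨c, hc⟩ := h.exists
    exact ⟨c, hc.2, hc.1⟩
  have h1 : ∀ᶠ b in nhdsWithin a s, f (u b) < c :=
    ((hu a ha).tendsto_nhdsWithin hus).eventually (hf (u a) (hus ha) c hc)
  have h2 : ∀ᶠ b in nhdsWithin a s, g b * c < y :=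
    ((hg a ha).mul_const c).eventually (gt_mem_nhds hcy)
  filter_upwards [h1, h2, self_mem_nhdsWithin] with b hb1 hb2 hbs
  exact (mul_le_mul_of_nonneg_left hb1.le (hg0 b hbs)).trans_lt hb2

/-- **Carathéodory's theorem** with exactly `n + 1` points and nonnegative weights. -/
theorem exists_fin_weights_of_mem_convexHull {n : ℕ} {X : Set (Fin n → ℝ)} {x : Fin n → ℝ}
    (hx : x ∈ convexHull ℝ X) :
    ∃ (lam : Fin (n + 1) → ℝ) (xs : Fin (n + 1) → Fin n → ℝ),
      (∀ k, 0 ≤ lam k) ∧ (∑ k, lam k = 1) ∧ (∀ k, xs k ∈ X) ∧ (∑ k, lam k • xs k = x) := by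
  obtain ⟨x₀, hx₀⟩ := convexHull_nonempty_iff.1 ⟨x, hx⟩
  obtain ⟨ι, _, z, w, hz, hai, hw, hw1, hwz⟩ := eq_pos_convex_span_of_mem_convexHull hx
  have hcard : Fintype.card ι ≤ n + 1 := by
    refine hai.card_le_finrank_succ.trans (Nat.succ_le_succ ?_)
    simpa using Submodule.finrank_le (vectorSpan ℝ (Set.range z))
  obtain ⟨e⟩ : Nonempty (ι ↪ Fin (n + 1)) :=
    Function.Embedding.nonempty_of_card_le (by simpa using hcard)
  have he := e.injective
  have hout : ∀ k ∉ Set.range e, Function.extend e w 0 k = 0 := fun k hk => by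
    rw [Function.extend_apply' _ _ _ hk, Pi.zero_apply]
  refine ⟨Function.extend e w 0, Function.extend e z fun _ => x₀, fun k => ?_, ?_, fun k => ?_, ?_⟩
  · by_cases hk : k ∈ Set.range e
    · obtain ⟨i, rfl⟩ := hk
      rw [he.extend_apply]
      exact (hw i).le
    · rw [hout k hk]
  · rw [← hw1]
    exact (Fintype.sum_of_injective e he _ _ hout fun i => by rw [he.extend_apply]).symm
  · by_cases hk : k ∈ Set.range e
    · obtain ⟨i, rfl⟩ := hk
      rw [he.extend_apply]
      exact hz ⟨i, rfl⟩
    · rwa [Function.extend_apply' _ _ _ hk]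
  · rw [← hwz]
    exact (Fintype.sum_of_injective e he _ _ (fun k hk => by rw [hout k hk, zero_smul])
      fun i => by rw [he.extend_apply, he.extend_apply]).symm

/-- The supremum defining the concave envelope is attained. -/
theorem exists_weights_eq_concaveEnvelope {n : ℕ} {X : Set (Fin n → ℝ)} (hX : IsCompact X)
    {f : (Fin n → ℝ) → ℝ} (hf : UpperSemicontinuousOn f X) {x : Fin n → ℝ}
    (hx : x ∈ convexHull ℝ X) :
    ∃ (lam : Fin (n + 1) → ℝ) (xs : Fin (n + 1) → Fin n → ℝ),
      (∀ k, 0 ≤ lam k) ∧ (∑ k, lam k = 1) ∧ (∀ k, xs k ∈ X) ∧ (∑ k, lam k • xs k = x) ∧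
      concaveEnvelope X f x = ∑ k, lam k * f (xs k) := by
  let C : Set ((Fin (n + 1) → ℝ) × (Fin (n + 1) → Fin n → ℝ)) :=
    (stdSimplex ℝ (Fin (n + 1)) ×ˢ Set.univ.pi fun _ => X) ∩ {p | ∑ k, p.1 k • p.2 k = x}
  have hC : IsCompact C :=
    ((isCompact_stdSimplex ℝ _).prod (isCompact_univ_pi fun _ => hX)).inter_right
      (isClosed_eq (by fun_prop) continuous_const)
  have hne : C.Nonempty := by
    obtain ⟨lam, xs, h0, h1, hX', hsum⟩ := exists_fin_weights_of_mem_convexHull hx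
    exact ⟨(lam, xs), ⟨⟨h0, h1⟩, fun k _ => hX' k⟩, hsum⟩
  have husc : UpperSemicontinuousOn (fun p => ∑ k, p.1 k * f (p.2 k)) C :=
    upperSemicontinuousOn_sum fun k _ =>
      hf.continuous_mul_comp (g := fun p : (Fin (n + 1) → ℝ) × (Fin (n + 1) → Fin n → ℝ) => p.1 k)
        (u := fun p => p.2 k) (by fun_prop) (by fun_prop)
        (fun p hp => hp.1.1.1 k) (fun p hp => hp.1.2 k trivial)
  obtain ⟨p, hp, hmax⟩ := husc.exists_isMaxOn hne hC
  refine ⟨p.1, p.2, hp.1.1.1, hp.1.1.2, fun k => hp.1.2 k trivial, hp.2,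
    IsGreatest.csSup_eq ⟨?_, ?_⟩⟩
  · exact ⟨p.1, p.2, hp.1.1.1, hp.1.1.2, fun k => hp.1.2 k trivial, hp.2, rfl⟩
  · rintro _ ⟨lam, xs, h0, h1, hX', hsum, rfl⟩
    exact hmax (show (lam, xs) ∈ C from ⟨⟨⟨h0, h1⟩, fun k _ => hX' k⟩, hsum⟩)

theorem exists_caratheodory_representation_of_concaveEnvelope
    {n : ℕ} (X : Set (Fin n → ℝ)) (hX : IsCompact X)
    (f : (Fin n → ℝ) → ℝ) (hf : UpperSemicontinuousOn f X)
    (x : Fin n → ℝ) (hx : x ∈ convexHull ℝ X) :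
    ∃ K : ℕ, 1 ≤ K ∧ K ≤ n + 1 ∧
      ∃ (xs : Fin K → Fin n → ℝ) (lam : Fin K → ℝ),
        (∀ k, xs k ∈ X) ∧ (∀ k, 0 < lam k) ∧ (∑ k, lam k = 1) ∧
        x = ∑ k, lam k • xs k ∧
        concaveEnvelope X f x = ∑ k, lam k * f (xs k) := by
  obtain ⟨lam, xs, h0, h1, hX', hsum, hval⟩ := exists_weights_eq_concaveEnvelope hX hf hx
  let e : Fin (Fintype.card {k // lam k ≠ 0}) ↪ Fin (n + 1) :=
    (Fintype.equivFin {k // lam k ≠ 0}).symm.toEmbedding.trans (Function.Embedding.subtype _)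
  have hout : ∀ k ∉ Set.range e, lam k = 0 := fun k hk => by
    by_contra hne
    exact hk ⟨Fintype.equivFin _ ⟨k, hne⟩, by simp [e]⟩
  have hsum1 : ∑ k, lam (e k) = 1 :=
    (Fintype.sum_of_injective e e.injective _ _ hout fun _ => rfl).trans h1
  refine ⟨_, ?_, ?_, xs ∘ e, lam ∘ e, fun k => hX' _, fun k => ?_, hsum1, ?_, ?_⟩
  · by_contra! hlt
    have : IsEmpty (Fin (Fintype.card {k // lam k ≠ 0})) := by
      rw [Nat.lt_one_iff.1 hlt]
      infer_instance
    simp at hsum1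
  · simpa only [Fintype.card_fin] using Fintype.card_le_of_embedding e
  · exact (h0 _).lt_of_ne' ((Fintype.equivFin {k // lam k ≠ 0}).symm k).2
  · rw [← hsum]
    exact (Fintype.sum_of_injective e e.injective _ _
      (fun k hk => by rw [hout k hk, zero_smul]) fun _ => rfl).symm
  · rw [hval]
    exact (Fintype.sum_of_injective e e.injective _ _
      (fun k hk => by rw [hout k hk, zero_mul]) fun _ => rfl).symm
end

section
/- Let X ⊆ ℝⁿ be a nonempty compact set, A a real p×n matrix, B a real p×m matrix, d ∈ ℝᵖ, and f : ℝⁿ → ℝ be upper semicontinuous on X. Define Z = { (x,y) ∈ X × ℝᵐ : ‖Ax + By + d‖₂ ≤ f(x) }. Assume (Assumption 1) for every x ∈ X there exists y ∈ ℝᵐ with ‖Ax + By + d‖₂ ≤ f(x), and (Assumption 2) every column of A and the vector d lie in the column space of B. Then the convex hull of Z equals W = { (x,y) ∈ conv(X) × ℝᵐ : ‖Ax + By + d‖₂ ≤ f̂(x) }, where f̂ is the concave envelope of f over conv(X); moreover conv(Z) is a closed set. -/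
open Finset Matrix

/-- The Euclidean norm on `ℝᵖ`. -/
noncomputable def euclNorm {p : ℕ} (v : Fin p → ℝ) : ℝ := Real.sqrt (∑ i, v i ^ 2)

section CaratheodoryWithCost

variable {E : Type*} [AddCommGroup E] [Module ℝ E]

/-- `x` is a convex combination of `N` points of `S` whose average cost is at least `t`. -/
def HasConvexComb (S : Set E) (c : E → ℝ) (N : ℕ) (x : E) (t : ℝ) : Prop :=
  ∃ (lam : Fin N → ℝ) (xs : Fin N → E), (∀ k, 0 ≤ lam k) ∧ (∑ k, lam k = 1) ∧
    (∀ k, xs k ∈ S) ∧ (∑ k, lam k • xs k = x) ∧ t ≤ ∑ k, lam k * c (xs k)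

/-- A nonzero direction with zero sum can be followed from a point of the nonnegative orthant
until some coordinate vanishes. -/
theorem exists_nonneg_add_mul_eq_zero {ι : Type*} [Fintype ι] {lam g : ι → ℝ}
    (hlam : ∀ k, 0 ≤ lam k) (hg : g ≠ 0) (hsum : ∑ k, g k = 0) :
    ∃ θ : ℝ, 0 ≤ θ ∧ (∀ k, 0 ≤ lam k + θ * g k) ∧ ∃ i, lam i + θ * g i = 0 := by
  classical
  have hneg : ∃ i, g i < 0 := by
    by_contra! h
    refine hg (funext fun k => ?_)
    exact (Finset.sum_eq_zero_iff_of_nonneg fun k _ => h k).1 hsum k (Finset.mem_univ k)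
  obtain ⟨j, hj⟩ := hneg
  obtain ⟨i, hi, hmin⟩ := Finset.exists_min_image (Finset.univ.filter fun k => g k < 0)
    (fun k => lam k / (-g k)) ⟨j, by simpa using hj⟩
  simp only [Finset.mem_filter, Finset.mem_univ, true_and] at hi hmin
  have hθ : 0 ≤ lam i / (-g i) := div_nonneg (hlam i) (by linarith)
  refine ⟨lam i / (-g i), hθ, fun k => ?_, i, ?_⟩
  · rcases lt_or_ge (g k) 0 with hk | hk
    · have := hmin k hk
      rw [le_div_iff₀ (by linarith)] at this
      linarith
    · have := hlam k
      positivity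
  · have : g i ≠ 0 := hi.ne
    field_simp
    ring

theorem HasConvexComb.of_succ [FiniteDimensional ℝ E] {S : Set E} {c : E → ℝ} {N : ℕ} {x : E}
    {t : ℝ} (hN : Module.finrank ℝ E + 1 ≤ N) (h : HasConvexComb S c (N + 1) x t) :
    HasConvexComb S c N x t := by
  obtain ⟨lam, xs, h0, h1, hS, hx, ht⟩ := h
  obtain ⟨g, hg0, hg1, hgx, hgc⟩ : ∃ g : Fin (N + 1) → ℝ, g ≠ 0 ∧ ∑ k, g k = 0 ∧
      ∑ k, g k • xs k = 0 ∧ 0 ≤ ∑ k, g k * c (xs k) := by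
    let L : (Fin (N + 1) → ℝ) →ₗ[ℝ] ℝ × E :=
      (Fintype.linearCombination ℝ (fun _ : Fin (N + 1) => (1 : ℝ))).prod
        (Fintype.linearCombination ℝ xs)
    have hker : LinearMap.ker L ≠ ⊥ := by
      apply LinearMap.ker_ne_bot_of_finrank_lt
      simp only [Module.finrank_prod, Module.finrank_self, Module.finrank_fintype_fun_eq_card,
        Fintype.card_fin]
      omega
    obtain ⟨g, hgL, hg0⟩ := Submodule.exists_mem_ne_zero_of_ne_bot hker
    have hL : ∑ k, g k = 0 ∧ ∑ k, g k • xs k = 0 := by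
      simpa [L, Fintype.linearCombination_apply, Prod.ext_iff] using hgL
    rcases le_total 0 (∑ k, g k * c (xs k)) with hc | hc
    · exact ⟨g, hg0, hL.1, hL.2, hc⟩
    · refine ⟨-g, neg_ne_zero.2 hg0, ?_, ?_, ?_⟩
      · simp [hL.1]
      · simp [hL.2]
      · simpa using hc
  obtain ⟨θ, hθ, hnn, i, hi⟩ := exists_nonneg_add_mul_eq_zero h0 hg0 hg1
  refine ⟨fun k => lam (i.succAbove k) + θ * g (i.succAbove k), fun k => xs (i.succAbove k),
    fun k => hnn _, ?_, fun k => hS _, ?_, ?_⟩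
  · have := Fin.sum_univ_succAbove (fun k => lam k + θ * g k) i
    rw [hi, zero_add, Finset.sum_add_distrib, ← Finset.mul_sum, h1, hg1] at this
    simpa using this.symm
  · have := Fin.sum_univ_succAbove (fun k => (lam k + θ * g k) • xs k) i
    simp only [hi, zero_smul, zero_add] at this
    rw [← this]
    simp only [add_smul, mul_smul, Finset.sum_add_distrib, ← Finset.smul_sum, hx, hgx]
    simp
  · have := Fin.sum_univ_succAbove (fun k => (lam k + θ * g k) * c (xs k)) i
    simp only [hi, zero_mul, zero_add] at this
    rw [← this]
    simp only [add_mul, mul_assoc, Finset.sum_add_distrib, ← Finset.mul_sum]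
    nlinarith [mul_nonneg hθ hgc]

theorem HasConvexComb.succ {S : Set E} {c : E → ℝ} {N : ℕ} {x : E} {t : ℝ}
    (hS : S.Nonempty) (h : HasConvexComb S c N x t) : HasConvexComb S c (N + 1) x t := by
  obtain ⟨lam, xs, h0, h1, hxs, hx, ht⟩ := h
  obtain ⟨s, hs⟩ := hS
  refine ⟨Fin.cons 0 lam, Fin.cons s xs, ?_, ?_, ?_, ?_, ?_⟩
  · exact Fin.cases (by simp) (by simpa using h0)
  · simpa [Fin.sum_univ_succ] using h1
  · exact Fin.cases (by simpa using hs) (by simpa using hxs)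
  · simpa [Fin.sum_univ_succ] using hx
  · simpa [Fin.sum_univ_succ] using ht

/-- Carathéodory's theorem, with control of the average cost. -/
theorem HasConvexComb.finrank_add_one [FiniteDimensional ℝ E] {S : Set E} {c : E → ℝ} {N : ℕ}
    {x : E} {t : ℝ} (hS : S.Nonempty) (h : HasConvexComb S c N x t) :
    HasConvexComb S c (Module.finrank ℝ E + 1) x t := by
  rcases le_total N (Module.finrank ℝ E + 1) with hN | hN
  · exact Nat.le_induction h (fun _ _ => HasConvexComb.succ hS) _ hN
  · induction N, hN using Nat.le_induction with
    | base => exact h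
    | succ k hk ih => exact ih (h.of_succ hk)

theorem HasConvexComb.of_fintype {ι : Type*} [Fintype ι] {S : Set E} {c : E → ℝ} {t : ℝ}
    {w : ι → ℝ} {z : ι → E} (h0 : ∀ i, 0 ≤ w i) (h1 : ∑ i, w i = 1) (hz : ∀ i, z i ∈ S)
    (ht : t ≤ ∑ i, w i * c (z i)) :
    HasConvexComb S c (Fintype.card ι) (∑ i, w i • z i) t := by
  let e := (Fintype.equivFin ι).symm
  refine ⟨w ∘ e, z ∘ e, fun k => h0 _, ?_, fun k => hz _, ?_, ?_⟩
  · rw [← h1]; exact e.sum_comp w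
  · exact e.sum_comp fun i => w i • z i
  · refine ht.trans_eq ?_
    exact (e.sum_comp fun i => w i * c (z i)).symm

end CaratheodoryWithCost

/-- In a finite-dimensional space the convex hull of a compact set is compact. -/
theorem isCompact_convexHull_of_finiteDimensional {E : Type*} [NormedAddCommGroup E]
    [NormedSpace ℝ E] [FiniteDimensional ℝ E] {S : Set E} (hS : IsCompact S) :
    IsCompact (convexHull ℝ S) := by
  rcases S.eq_empty_or_nonempty with rfl | hne
  · simp
  let N := Module.finrank ℝ E + 1
  have hK : IsCompact (stdSimplex ℝ (Fin N) ×ˢ Set.univ.pi fun _ : Fin N => S) :=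
    (isCompact_stdSimplex ℝ (Fin N)).prod (isCompact_univ_pi fun _ => hS)
  convert hK.image (f := fun q : (Fin N → ℝ) × (Fin N → E) => ∑ k, q.1 k • q.2 k)
    (by fun_prop) using 1
  ext x
  constructor
  · intro hx
    obtain ⟨ι, _, w, z, h0, h1, hz, rfl⟩ := mem_convexHull_iff_exists_fintype.1 hx
    obtain ⟨lam, xs, h0, h1, hxs, hx, -⟩ :=
      (HasConvexComb.of_fintype (c := fun _ => 0) (t := 0) h0 h1 hz (by simp)).finrank_add_one hne
    exact ⟨(lam, xs), ⟨⟨h0, h1⟩, fun k _ => hxs k⟩, hx⟩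
  · rintro ⟨⟨lam, xs⟩, ⟨⟨h0, h1⟩, hxs⟩, rfl⟩
    exact mem_convexHull_of_exists_fintype lam xs h0 h1 (fun k => hxs k trivial) rfl

section EuclNorm

variable {p : ℕ}

theorem euclNorm_eq_norm (v : Fin p → ℝ) : euclNorm v = ‖WithLp.toLp 2 v‖ := by
  simp [euclNorm, EuclideanSpace.norm_eq]

theorem euclNorm_nonneg (v : Fin p → ℝ) : 0 ≤ euclNorm v := Real.sqrt_nonneg _

theorem euclNorm_add_le (v w : Fin p → ℝ) : euclNorm (v + w) ≤ euclNorm v + euclNorm w := by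
  simpa only [euclNorm_eq_norm, WithLp.toLp_add] using norm_add_le _ _

theorem euclNorm_smul {a : ℝ} (ha : 0 ≤ a) (v : Fin p → ℝ) :
    euclNorm (a • v) = a * euclNorm v := by
  simp only [euclNorm_eq_norm, WithLp.toLp_smul, norm_smul, Real.norm_of_nonneg ha]

theorem eq_zero_of_euclNorm_le_zero {v : Fin p → ℝ} (h : euclNorm v ≤ 0) : v = 0 := by
  rw [euclNorm_eq_norm] at h
  simpa using norm_le_zero_iff.1 h

theorem continuous_euclNorm : Continuous (euclNorm : (Fin p → ℝ) → ℝ) := by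
  unfold euclNorm
  fun_prop

end EuclNorm

section Hypograph

variable {n : ℕ} {X : Set (Fin n → ℝ)} {f : (Fin n → ℝ) → ℝ}

/-- The part of the hypograph of `f` over `X` lying above height zero. -/
def nonnegHypograph (X : Set (Fin n → ℝ)) (f : (Fin n → ℝ) → ℝ) : Set ((Fin n → ℝ) × ℝ) :=
  {q | q.1 ∈ X ∧ 0 ≤ q.2 ∧ q.2 ≤ f q.1}

theorem isCompact_nonnegHypograph (hX : IsCompact X) (hf : UpperSemicontinuousOn f X) :
    IsCompact (nonnegHypograph X f) := by
  obtain ⟨M, hM⟩ := hf.bddAbove_of_isCompact hX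
  refine (hX.prod (isCompact_Icc (a := (0 : ℝ)) (b := M))).of_isClosed_subset ?_ ?_
  · have h1 := (upperSemicontinuousOn_iff_isClosed_hypograph hX.isClosed).1 hf
    have h2 : IsClosed {q : (Fin n → ℝ) × ℝ | 0 ≤ q.2} :=
      isClosed_le continuous_const continuous_snd
    convert h1.inter h2 using 1
    ext q
    simp only [nonnegHypograph, Set.mem_ofPred_eq, Set.mem_inter_iff]
    tauto
  · rintro q ⟨h1, h2, h3⟩
    exact ⟨h1, h2, h3.trans (hM (Set.mem_image_of_mem f h1))⟩

theorem fst_mem_convexHull_of_mem {q : (Fin n → ℝ) × ℝ}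
    (hq : q ∈ convexHull ℝ (nonnegHypograph X f)) : q.1 ∈ convexHull ℝ X := by
  have := Set.mem_image_of_mem (LinearMap.fst ℝ (Fin n → ℝ) ℝ) hq
  rw [LinearMap.image_convexHull] at this
  refine convexHull_mono ?_ this
  rintro _ ⟨r, hr, rfl⟩
  exact hr.1

/-- A finite convex combination of points of `nonnegHypograph X f` lies below the concave
envelope. -/
theorem le_concaveEnvelope (hX : IsCompact X) (hf : UpperSemicontinuousOn f X)
    {q : (Fin n → ℝ) × ℝ} (hq : q ∈ convexHull ℝ (nonnegHypograph X f)) :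
    q.2 ≤ concaveEnvelope X f q.1 := by
  obtain ⟨M, hM⟩ := hf.bddAbove_of_isCompact hX
  obtain ⟨ι, _, w, z, h0, h1, hz, rfl⟩ := mem_convexHull_iff_exists_fintype.1 hq
  have hne : X.Nonempty := by
    rcases isEmpty_or_nonempty ι with h | ⟨⟨i⟩⟩
    · simp at h1
    · exact ⟨_, (hz i).1⟩
  have hrep := (HasConvexComb.of_fintype (c := f) (t := ∑ i, w i * (z i).2) h0 h1
    (fun i => (hz i).1) (Finset.sum_le_sum fun i _ =>
      mul_le_mul_of_nonneg_left (hz i).2.2 (h0 i))).finrank_add_one hne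
  rw [Module.finrank_fin_fun] at hrep
  obtain ⟨lam, xs, hl0, hl1, hxs, hx, ht⟩ := hrep
  simp only [Prod.fst_sum, Prod.snd_sum, Prod.smul_fst, Prod.smul_snd, smul_eq_mul]
  refine ht.trans (le_csSup ⟨M, ?_⟩ ⟨lam, xs, hl0, hl1, hxs, hx, rfl⟩)
  rintro _ ⟨mu, ys, hm0, hm1, hys, -, rfl⟩
  calc ∑ k, mu k * f (ys k) ≤ ∑ k, mu k * M := Finset.sum_le_sum fun k _ =>
        mul_le_mul_of_nonneg_left (hM (Set.mem_image_of_mem f (hys k))) (hm0 k)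
    _ = M := by rw [← Finset.sum_mul, hm1, one_mul]

theorem mk_concaveEnvelope_mem (hX : IsCompact X) (hf : UpperSemicontinuousOn f X)
    (hf0 : ∀ x ∈ X, 0 ≤ f x) {x : Fin n → ℝ} (hx : x ∈ convexHull ℝ X) :
    (x, concaveEnvelope X f x) ∈ convexHull ℝ (nonnegHypograph X f) := by
  have hclosed := (isCompact_convexHull_of_finiteDimensional
    (isCompact_nonnegHypograph hX hf)).isClosed
  have hfib : IsClosed {s : ℝ | (x, s) ∈ convexHull ℝ (nonnegHypograph X f)} :=
    hclosed.preimage (Continuous.prodMk_right x)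
  have hsub : { s : ℝ | ∃ (lam : Fin (n + 1) → ℝ) (xs : Fin (n + 1) → Fin n → ℝ),
      (∀ k, 0 ≤ lam k) ∧ (∑ k, lam k = 1) ∧ (∀ k, xs k ∈ X) ∧
      (∑ k, lam k • xs k = x) ∧ s = ∑ k, lam k * f (xs k) } ⊆
      {s : ℝ | (x, s) ∈ convexHull ℝ (nonnegHypograph X f)} := by
    rintro _ ⟨lam, xs, h0, h1, hxs, hx, rfl⟩
    refine mem_convexHull_of_exists_fintype lam (fun k => (xs k, f (xs k))) h0 h1
      (fun k => ⟨hxs k, hf0 _ (hxs k), le_rfl⟩) ?_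
    ext1
    · simpa [Prod.fst_sum] using hx
    · simp [Prod.snd_sum]
  refine hfib.closure_subset_iff.2 hsub (csSup_mem_closure ?_ ?_)
  · obtain ⟨ι, _, w, z, h0, h1, hz, rfl⟩ := mem_convexHull_iff_exists_fintype.1 hx
    have hrep := (HasConvexComb.of_fintype (c := f) h0 h1 hz le_rfl).finrank_add_one
      (convexHull_nonempty_iff.1 ⟨_, hx⟩)
    rw [Module.finrank_fin_fun] at hrep
    obtain ⟨lam, xs, hl0, hl1, hxs, hx, -⟩ := hrep
    exact ⟨_, lam, xs, hl0, hl1, hxs, hx, rfl⟩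
  · exact ⟨concaveEnvelope X f x, fun s hs => le_concaveEnvelope hX hf (hsub hs)⟩

/-- The convex hull of `nonnegHypograph X f` is the part above height zero of the hypograph of
the concave envelope. -/
theorem mem_convexHull_nonnegHypograph_iff (hX : IsCompact X) (hf : UpperSemicontinuousOn f X)
    (hf0 : ∀ x ∈ X, 0 ≤ f x) {x : Fin n → ℝ} {r : ℝ} (hr : 0 ≤ r) :
    (x, r) ∈ convexHull ℝ (nonnegHypograph X f) ↔
      x ∈ convexHull ℝ X ∧ r ≤ concaveEnvelope X f x := by
  refine ⟨fun h => ⟨fst_mem_convexHull_of_mem h, le_concaveEnvelope hX hf h⟩, ?_⟩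
  rintro ⟨hx, hrx⟩
  have htop := mk_concaveEnvelope_mem hX hf hf0 hx
  have hbot : (x, (0 : ℝ)) ∈ convexHull ℝ (nonnegHypograph X f) := by
    have := Set.mem_image_of_mem (LinearMap.inl ℝ (Fin n → ℝ) ℝ) hx
    rw [LinearMap.image_convexHull] at this
    refine convexHull_mono ?_ this
    rintro _ ⟨y, hy, rfl⟩
    exact ⟨hy, le_rfl, hf0 y hy⟩
  have hconv : Convex ℝ {s : ℝ | (x, s) ∈ convexHull ℝ (nonnegHypograph X f)} := by
    intro s hs t ht a b ha hb hab
    have := convex_convexHull ℝ _ hs ht ha hb hab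
    simpa [← add_smul, hab] using this
  exact hconv.ordConnected.out hbot htop ⟨hr, hrx⟩

end Hypograph

/-- If the columns of `A` and the vector `d` lie in the column space of `B`, then `y` can be
chosen so that `A x + B y + d` is any prescribed vector of that column space. -/
theorem exists_mulVec_add_eq {n m p : ℕ} {A : Matrix (Fin p) (Fin n) ℝ}
    {B : Matrix (Fin p) (Fin m) ℝ} {d v : Fin p → ℝ}
    (hA : ∀ j : Fin n, (fun i => A i j) ∈ LinearMap.range B.mulVecLin)
    (hd : d ∈ LinearMap.range B.mulVecLin) (hv : v ∈ LinearMap.range B.mulVecLin)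
    (x : Fin n → ℝ) : ∃ y : Fin m → ℝ, A.mulVec x + B.mulVec y + d = v := by
  have hAx : A.mulVec x ∈ LinearMap.range B.mulVecLin := by
    have hle : LinearMap.range A.mulVecLin ≤ LinearMap.range B.mulVecLin := by
      rw [Matrix.range_mulVecLin A, Submodule.span_le]
      rintro _ ⟨j, rfl⟩
      exact hA j
    exact hle ⟨x, rfl⟩
  obtain ⟨y, hy⟩ := Submodule.sub_mem _ (Submodule.sub_mem _ hv hAx) hd
  refine ⟨y, ?_⟩
  rw [Matrix.mulVecLin_apply] at hy
  rw [hy]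
  abel

theorem convexHull_eq_of_concaveEnvelope
    {n m p : ℕ} (X : Set (Fin n → ℝ)) (hXne : X.Nonempty) (hX : IsCompact X)
    (A : Matrix (Fin p) (Fin n) ℝ) (B : Matrix (Fin p) (Fin m) ℝ) (d : Fin p → ℝ)
    (f : (Fin n → ℝ) → ℝ) (hf : UpperSemicontinuousOn f X)
    -- Assumption 1: for every x ∈ X there is y with ‖Ax + By + d‖₂ ≤ f(x)
    (hA1 : ∀ x ∈ X, ∃ y : Fin m → ℝ, euclNorm (A.mulVec x + B.mulVec y + d) ≤ f x)
    -- Assumption 2: columns of A and the vector d lie in the column space of B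
    (hA2col : ∀ j : Fin n, (fun i => A i j) ∈ LinearMap.range B.mulVecLin)
    (hA2d : d ∈ LinearMap.range B.mulVecLin) :
    convexHull ℝ {q : (Fin n → ℝ) × (Fin m → ℝ) | q.1 ∈ X ∧
        euclNorm (A.mulVec q.1 + B.mulVec q.2 + d) ≤ f q.1}
      = {q : (Fin n → ℝ) × (Fin m → ℝ) | q.1 ∈ convexHull ℝ X ∧
        euclNorm (A.mulVec q.1 + B.mulVec q.2 + d) ≤ concaveEnvelope X f q.1} ∧
    IsClosed (convexHull ℝ {q : (Fin n → ℝ) × (Fin m → ℝ) | q.1 ∈ X ∧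
        euclNorm (A.mulVec q.1 + B.mulVec q.2 + d) ≤ f q.1}) := by
  have hf0 : ∀ x ∈ X, 0 ≤ f x := fun x hx => by
    obtain ⟨y, hy⟩ := hA1 x hx
    exact (euclNorm_nonneg _).trans hy
  have hmem (q : (Fin n → ℝ) × (Fin m → ℝ)) :=
    mem_convexHull_nonnegHypograph_iff hX hf hf0 (x := q.1)
      (euclNorm_nonneg (A.mulVec q.1 + B.mulVec q.2 + d))
  set G : (Fin n → ℝ) × (Fin m → ℝ) → Fin p → ℝ :=
    fun q => A.mulVec q.1 + B.mulVec q.2 + d with hG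
  have heq : convexHull ℝ {q : (Fin n → ℝ) × (Fin m → ℝ) | q.1 ∈ X ∧ euclNorm (G q) ≤ f q.1}
      = {q : (Fin n → ℝ) × (Fin m → ℝ) | q.1 ∈ convexHull ℝ X ∧
        euclNorm (G q) ≤ concaveEnvelope X f q.1} := by
    refine Set.Subset.antisymm (convexHull_min ?_ ?_) ?_
    · rintro q ⟨hq1, hq2⟩
      exact (hmem q).1 (subset_convexHull ℝ _ ⟨hq1, euclNorm_nonneg _, hq2⟩)
    · rintro q ⟨hq1, hq2⟩ r ⟨hr1, hr2⟩ a b ha hb hab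
      refine ⟨convex_convexHull ℝ X hq1 hr1 ha hb hab, ?_⟩
      have hGab : G (a • q + b • r) = a • G q + b • G r := by
        have hd : d = a • d + b • d := by rw [← add_smul, hab, one_smul]
        simp only [hG, Prod.fst_add, Prod.snd_add, Prod.smul_fst, Prod.smul_snd,
          Matrix.mulVec_add, Matrix.mulVec_smul, smul_add]
        nth_rewrite 1 [hd]
        abel
      have henv := le_concaveEnvelope hX hf (convex_convexHull ℝ _
        (mk_concaveEnvelope_mem hX hf hf0 hq1) (mk_concaveEnvelope_mem hX hf hf0 hr1) ha hb hab)
      calc euclNorm (G (a • q + b • r)) ≤ a * euclNorm (G q) + b * euclNorm (G r) := by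
            rw [hGab, ← euclNorm_smul ha, ← euclNorm_smul hb]
            exact euclNorm_add_le _ _
        _ ≤ a * concaveEnvelope X f q.1 + b * concaveEnvelope X f r.1 := by gcongr
        _ ≤ _ := henv
    · rintro ⟨x, y⟩ ⟨hx, hy⟩
      set F := concaveEnvelope X f x
      set v := G (x, y) with hv
      have hvB : v ∈ LinearMap.range B.mulVecLin := by
        obtain ⟨y', hy'⟩ := exists_mulVec_add_eq hA2col hA2d (Submodule.zero_mem _) x
        refine ⟨y - y', ?_⟩
        rw [Matrix.mulVecLin_apply, Matrix.mulVec_sub, hv, ← sub_zero (G (x, y)), ← hy']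
        simp only [hG]
        abel
      obtain ⟨ι, _, w, z, h0, h1, hz, hsum⟩ :=
        mem_convexHull_iff_exists_fintype.1 (mk_concaveEnvelope_mem hX hf hf0 hx)
      have hsum1 : ∑ i, w i • (z i).1 = x := by
        simpa [Prod.fst_sum] using congrArg Prod.fst hsum
      have hsum2 : ∑ i, w i * (z i).2 = F := by
        simpa [Prod.snd_sum] using congrArg Prod.snd hsum
      have hF : 0 ≤ F := (euclNorm_nonneg _).trans hy
      have hscale : (F / F) • v = v := by
        rcases hF.eq_or_lt with h | h
        · rw [eq_zero_of_euclNorm_le_zero (hy.trans_eq h.symm), smul_zero]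
        · rw [div_self h.ne', one_smul]
      choose u hu using fun i => exists_mulVec_add_eq hA2col hA2d
        (Submodule.smul_mem _ ((z i).2 / F) hvB) (z i).1
      have hBu : B.mulVec (∑ i, w i • u i) = B.mulVec y := by
        have hcomb : ∑ i, w i • (A.mulVec (z i).1 + B.mulVec (u i) + d) = v := by
          simp only [hu, smul_smul]
          rw [← Finset.sum_smul]
          simp only [← mul_div_assoc]
          rw [← Finset.sum_div, hsum2, hscale]
        simp only [smul_add, Finset.sum_add_distrib, ← Matrix.mulVec_smul] at hcomb
        rw [← Matrix.mulVec_sum, ← Matrix.mulVec_sum, hsum1, ← Finset.sum_smul, h1, one_smul,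
          hv] at hcomb
        exact add_left_cancel (add_right_cancel hcomb)
      refine mem_convexHull_of_exists_fintype w
        (fun i => ((z i).1, u i + (y - ∑ j, w j • u j))) h0 h1 (fun i => ⟨(hz i).1, ?_⟩) ?_
      · have hGi : G ((z i).1, u i + (y - ∑ j, w j • u j)) = ((z i).2 / F) • v := by
          simp only [hG, Matrix.mulVec_add, Matrix.mulVec_sub, hBu, sub_self, add_zero]
          exact hu i
        rw [hGi, euclNorm_smul (div_nonneg (hz i).2.1 hF)]
        refine le_trans ?_ (hz i).2.2
        calc (z i).2 / F * euclNorm v ≤ (z i).2 / F * F :=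
              mul_le_mul_of_nonneg_left hy (div_nonneg (hz i).2.1 hF)
          _ ≤ (z i).2 := by
              rcases hF.eq_or_lt with h | h
              · simpa [← h] using (hz i).2.1
              · rw [div_mul_cancel₀ _ h.ne']
      · ext1
        · simpa [Prod.fst_sum] using hsum1
        · simp [Prod.snd_sum, smul_add, Finset.sum_add_distrib, ← Finset.sum_smul, h1]
  refine ⟨heq, heq ▸ ?_⟩
  have hcont : Continuous fun q : (Fin n → ℝ) × (Fin m → ℝ) => (q.1, euclNorm (G q)) := by
    refine continuous_fst.prodMk (continuous_euclNorm.comp ?_)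
    have hA := LinearMap.continuous_of_finiteDimensional A.mulVecLin
    have hB := LinearMap.continuous_of_finiteDimensional B.mulVecLin
    exact ((hA.comp continuous_fst).add (hB.comp continuous_snd)).add continuous_const
  convert (isCompact_convexHull_of_finiteDimensional
    (isCompact_nonnegHypograph hX hf)).isClosed.preimage hcont using 1
  ext q
  exact (hmem q).symm
end

section
/- Let X ⊆ ℝⁿ be a compact set, f : ℝⁿ → ℝ be upper semicontinuous and nonnegative on X, and let q : ℝⁿ → ℝ satisfy q(x) = f(x)² for all x ∈ X. Let f̂ and q̂ be the concave envelopes over conv(X) of f and q respectively. Then the function x ↦ √(q̂(x)) is concave and upper semicontinuous on conv(X), and √(q̂(x)) ≥ f̂(x) for all x ∈ conv(X). -/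
open Finset

open Filter Topology

/-- The values of the convex combinations of `f` over `m` points of `X` averaging to `x`. -/
def combinationValues {n : ℕ} (m : ℕ) (X : Set (Fin n → ℝ)) (f : (Fin n → ℝ) → ℝ)
    (x : Fin n → ℝ) : Set ℝ :=
  { s : ℝ | ∃ (lam : Fin m → ℝ) (xs : Fin m → Fin n → ℝ),
    (∀ k, 0 ≤ lam k) ∧ (∑ k, lam k = 1) ∧ (∀ k, xs k ∈ X) ∧
    (∑ k, lam k • xs k = x) ∧ s = ∑ k, lam k * f (xs k) }

/-- A family of more than `n + 1` points of `ℝⁿ` has a nontrivial affine relation on which a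
given linear functional of the coefficients is nonnegative. -/
theorem exists_affine_relation_nonneg {n m : ℕ} (hm : n + 1 < m) (xs : Fin m → Fin n → ℝ)
    (c : Fin m → ℝ) :
    ∃ μ : Fin m → ℝ, ∑ k, μ k = 0 ∧ ∑ k, μ k • xs k = 0 ∧ 0 ≤ ∑ k, μ k * c k ∧
      ∃ i, μ i < 0 := by
  have hdep : ¬ AffineIndependent ℝ xs := by
    intro h
    have h1 := h.card_le_finrank_succ
    have h2 := Submodule.finrank_le (vectorSpan ℝ (Set.range xs))
    simp only [Fintype.card_fin, Module.finrank_fin_fun] at h1 h2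
    omega
  rw [affineIndependent_iff] at hdep
  push Not at hdep
  obtain ⟨s, w, hw0, hw1, e, he, hwe⟩ := hdep
  obtain ⟨ν, hν0, hν1, hνe⟩ : ∃ ν : Fin m → ℝ, ∑ k, ν k = 0 ∧ ∑ k, ν k • xs k = 0 ∧
      ∃ i, ν i ≠ 0 := by
    refine ⟨fun k => if k ∈ s then w k else 0, ?_, ?_, e, by simpa [he] using hwe⟩
    · simpa using hw0
    · simpa [ite_smul] using hw1
  obtain ⟨μ, hμ0, hμ1, hμe, hμc⟩ : ∃ μ : Fin m → ℝ, ∑ k, μ k = 0 ∧ ∑ k, μ k • xs k = 0 ∧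
      (∃ i, μ i ≠ 0) ∧ 0 ≤ ∑ k, μ k * c k := by
    rcases le_total 0 (∑ k, ν k * c k) with h | h
    · exact ⟨ν, hν0, hν1, hνe, h⟩
    · exact ⟨-ν, by simp [hν0], by simp [hν1], by simpa using hνe, by simpa using h⟩
  refine ⟨μ, hμ0, hμ1, hμc, ?_⟩
  by_contra! hnn
  obtain ⟨i, hi⟩ := hμe
  exact hi ((sum_eq_zero_iff_of_nonneg fun k _ => hnn k).1 hμ0 i (mem_univ i))

/-- One point of a convex combination of more than `n + 1` points can be dropped without
decreasing the value. -/
theorem exists_le_combinationValues_pred {n m : ℕ} (hm : n + 1 ≤ m) {X : Set (Fin n → ℝ)}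
    {f : (Fin n → ℝ) → ℝ} {x : Fin n → ℝ} {s : ℝ} (hs : s ∈ combinationValues (m + 1) X f x) :
    ∃ t ∈ combinationValues m X f x, s ≤ t := by
  obtain ⟨lam, xs, h0, h1, hX, hx, rfl⟩ := hs
  obtain ⟨μ, hμ0, hμ1, hμc, j, hj⟩ :=
    exists_affine_relation_nonneg (by omega : n + 1 < m + 1) xs (fun k => f (xs k))
  obtain ⟨i, hi, hmin⟩ := exists_min_image (univ.filter fun k => μ k < 0)
    (fun k => lam k / (-μ k)) ⟨j, by simpa using hj⟩
  simp only [mem_filter, mem_univ, true_and] at hi hmin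
  set r := lam i / (-μ i) with hr
  have hr0 : 0 ≤ r := div_nonneg (h0 i) (by linarith)
  have hi0 : lam i + r * μ i = 0 := by
    have : μ i ≠ 0 := hi.ne
    rw [hr]; field_simp; ring
  have hnn : ∀ k, 0 ≤ lam k + r * μ k := by
    intro k
    rcases lt_or_ge (μ k) 0 with hk | hk
    · have := (le_div_iff₀ (by linarith : 0 < -μ k)).1 (hmin k hk)
      linarith
    · exact add_nonneg (h0 k) (mul_nonneg hr0 hk)
  have hsum : ∑ k, (lam k + r * μ k) = 1 := by
    rw [sum_add_distrib, ← mul_sum, hμ0, h1]; simp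
  have hpt : ∑ k, (lam k + r * μ k) • xs k = x := by
    simp only [add_smul, mul_smul]
    rw [sum_add_distrib, ← smul_sum, hμ1, hx]; simp
  have hval : ∑ k, lam k * f (xs k) ≤ ∑ k, (lam k + r * μ k) * f (xs k) := by
    simp only [add_mul, mul_assoc]
    rw [sum_add_distrib, ← mul_sum]
    linarith [mul_nonneg hr0 hμc]
  rw [Fin.sum_univ_succAbove _ i, hi0] at hsum hpt
  rw [Fin.sum_univ_succAbove (fun k => (lam k + r * μ k) * f (xs k)) i, hi0] at hval
  exact ⟨_, ⟨fun k => lam (i.succAbove k) + r * μ (i.succAbove k), fun k => xs (i.succAbove k),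
    fun k => hnn _, by simpa using hsum, fun k => hX _, by simpa using hpt, rfl⟩,
    by simpa using hval⟩

/-- Carathéodory reduction: `n + 1` points suffice to reach at least any given value. -/
theorem exists_le_combinationValues {n m : ℕ} (hm : n + 1 ≤ m) {X : Set (Fin n → ℝ)}
    {f : (Fin n → ℝ) → ℝ} {x : Fin n → ℝ} {s : ℝ} (hs : s ∈ combinationValues m X f x) :
    ∃ t ∈ combinationValues (n + 1) X f x, s ≤ t := by
  induction m, hm using Nat.le_induction generalizing s with
  | base => exact ⟨s, hs, le_rfl⟩
  | succ m hm ih =>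
    obtain ⟨t, ht, hst⟩ := exists_le_combinationValues_pred hm hs
    obtain ⟨u, hu, htu⟩ := ih ht
    exact ⟨u, hu, hst.trans htu⟩

theorem add_mem_combinationValues {n m l : ℕ} {X : Set (Fin n → ℝ)} {f : (Fin n → ℝ) → ℝ}
    {x y : Fin n → ℝ} {s t a b : ℝ} (hs : s ∈ combinationValues m X f x)
    (ht : t ∈ combinationValues l X f y) (ha : 0 ≤ a) (hb : 0 ≤ b) (hab : a + b = 1) :
    a * s + b * t ∈ combinationValues (m + l) X f (a • x + b • y) := by
  obtain ⟨lam, xs, h0, h1, hX, hx, rfl⟩ := hs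
  obtain ⟨lam', xs', h0', h1', hX', hy, rfl⟩ := ht
  refine ⟨Fin.append (fun k => a * lam k) (fun k => b * lam' k), Fin.append xs xs',
    ?_, ?_, ?_, ?_, ?_⟩
  · intro k
    refine Fin.addCases (fun i => ?_) (fun i => ?_) k
    · simpa using mul_nonneg ha (h0 i)
    · simpa using mul_nonneg hb (h0' i)
  · simp [Fin.sum_univ_add, ← mul_sum, h1, h1', hab]
  · intro k
    refine Fin.addCases (fun i => ?_) (fun i => ?_) k
    · simpa using hX i
    · simpa using hX' i
  · simp [Fin.sum_univ_add, mul_smul, ← smul_sum, hx, hy]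
  · simp [Fin.sum_univ_add, mul_assoc, ← mul_sum]

theorem combinationValues_nonempty {n : ℕ} {X : Set (Fin n → ℝ)} (f : (Fin n → ℝ) → ℝ)
    {x : Fin n → ℝ} (hx : x ∈ convexHull ℝ X) : (combinationValues (n + 1) X f x).Nonempty := by
  have hconv : Convex ℝ {x | (combinationValues (n + 1) X f x).Nonempty} := by
    rintro x ⟨s, hs⟩ y ⟨t, ht⟩ a b ha hb hab
    obtain ⟨u, hu, -⟩ :=
      exists_le_combinationValues (by omega) (add_mem_combinationValues hs ht ha hb hab)
    exact ⟨u, hu⟩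
  refine convexHull_min (fun z hz => ?_) hconv hx
  exact ⟨_, Pi.single 0 1, fun _ => z, fun k => by
    by_cases hk : k = 0 <;> simp [hk], by simp, fun _ => hz,
    by simp [← sum_smul], rfl⟩

theorem bddAbove_combinationValues {n m : ℕ} {X : Set (Fin n → ℝ)} {f : (Fin n → ℝ) → ℝ}
    (hf : BddAbove (f '' X)) (x : Fin n → ℝ) : BddAbove (combinationValues m X f x) := by
  obtain ⟨M, hM⟩ := hf
  refine ⟨M, ?_⟩
  rintro _ ⟨lam, xs, h0, h1, hX, -, rfl⟩
  calc ∑ k, lam k * f (xs k) ≤ ∑ k, lam k * M :=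
        sum_le_sum fun k _ =>
          mul_le_mul_of_nonneg_left (hM (Set.mem_image_of_mem f (hX k))) (h0 k)
    _ = M := by rw [← sum_mul, h1, one_mul]

theorem concaveOn_concaveEnvelope {n : ℕ} {X : Set (Fin n → ℝ)} {f : (Fin n → ℝ) → ℝ}
    (hf : BddAbove (f '' X)) : ConcaveOn ℝ (convexHull ℝ X) (concaveEnvelope X f) := by
  refine ⟨convex_convexHull ℝ X, fun x hx y hy a b ha hb hab => ?_⟩
  refine le_of_forall_pos_le_add fun ε hε => ?_
  obtain ⟨s, hs, hsx⟩ := exists_lt_of_lt_csSup (combinationValues_nonempty f hx)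
    (show concaveEnvelope X f x - ε < _ from sub_lt_self _ hε)
  obtain ⟨t, ht, hty⟩ := exists_lt_of_lt_csSup (combinationValues_nonempty f hy)
    (show concaveEnvelope X f y - ε < _ from sub_lt_self _ hε)
  obtain ⟨u, hu, hle⟩ :=
    exists_le_combinationValues (by omega) (add_mem_combinationValues hs ht ha hb hab)
  have hu' : u ≤ concaveEnvelope X f (a • x + b • y) :=
    le_csSup (bddAbove_combinationValues hf _) hu
  simp only [smul_eq_mul]
  have h1 := mul_le_mul_of_nonneg_left hsx.le ha
  have h2 := mul_le_mul_of_nonneg_left hty.le hb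
  have h3 : a * ε + b * ε = ε := by rw [← add_mul, hab, one_mul]
  linarith

theorem ContinuousOn.mul_upperSemicontinuousOn {α : Type*} [TopologicalSpace α] {s : Set α}
    {f g : α → ℝ} (hf : ContinuousOn f s) (hf0 : ∀ x ∈ s, 0 ≤ f x)
    (hg : UpperSemicontinuousOn g s) : UpperSemicontinuousOn (fun x => f x * g x) s := by
  intro x hx y hy
  have hc : ∀ᶠ b in 𝓝 (g x), f x * b < y :=
    (continuous_const.mul continuous_id).continuousAt.eventually_lt continuousAt_const hy
  obtain ⟨b, hb, hgb⟩ :=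
    ((hc.filter_mono (nhdsWithin_le_nhds (s := Set.Ioi (g x)))).and self_mem_nhdsWithin).exists
  have hfb : ∀ᶠ z in 𝓝[s] x, f z * b < y :=
    ((hf x hx).mul continuousWithinAt_const).eventually_lt continuousWithinAt_const hb
  filter_upwards [hfb, hg x hx b hgb, self_mem_nhdsWithin] with z h1 h2 hz
  exact (mul_le_mul_of_nonneg_left h2.le (hf0 z hz)).trans_lt h1

theorem UpperSemicontinuousOn.sq {α : Type*} [TopologicalSpace α] {s : Set α} {f : α → ℝ}
    (hf : UpperSemicontinuousOn f s) (hf0 : ∀ x ∈ s, 0 ≤ f x) :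
    UpperSemicontinuousOn (fun x => f x ^ 2) s := by
  intro x hx y hy
  have hlt : f x < √y := Real.lt_sqrt_of_sq_lt hy
  filter_upwards [hf x hx _ hlt, self_mem_nhdsWithin] with z hz hzs
  exact (Real.lt_sqrt (hf0 z hzs)).1 hz

theorem upperSemicontinuousOn_concaveEnvelope {n : ℕ} {X : Set (Fin n → ℝ)} (hX : IsCompact X)
    {f : (Fin n → ℝ) → ℝ} (hf : UpperSemicontinuousOn f X) :
    UpperSemicontinuousOn (concaveEnvelope X f) (convexHull ℝ X) := by
  intro x hx y hy
  obtain ⟨c, hc, hcy⟩ := exists_between hy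
  set K : Set ((Fin (n + 1) → ℝ) × (Fin (n + 1) → Fin n → ℝ)) :=
    stdSimplex ℝ (Fin (n + 1)) ×ˢ Set.univ.pi fun _ => X
  have hK : IsCompact K := (isCompact_stdSimplex ℝ _).prod (isCompact_univ_pi fun _ => hX)
  have husc : UpperSemicontinuousOn
      (fun p : (Fin (n + 1) → ℝ) × (Fin (n + 1) → Fin n → ℝ) => ∑ k, p.1 k * f (p.2 k)) K := by
    refine upperSemicontinuousOn_sum fun k _ => ?_
    refine ContinuousOn.mul_upperSemicontinuousOn (by fun_prop) (fun p hp => hp.1.1 k) ?_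
    exact hf.comp (g := fun p : (Fin (n + 1) → ℝ) × (Fin (n + 1) → Fin n → ℝ) => p.2 k)
      (by fun_prop) fun p hp => hp.2 k (Set.mem_univ k)
  have hclosed := ((husc.isCompact_inter_preimage_Ici hK c).image
    (f := fun p => ∑ k, p.1 k • p.2 k) (by fun_prop)).isClosed
  have hbdd := bddAbove_combinationValues (m := n + 1) (hf.bddAbove_of_isCompact hX) x
  have hmem : x ∉ (fun p : (Fin (n + 1) → ℝ) × (Fin (n + 1) → Fin n → ℝ) =>
      ∑ k, p.1 k • p.2 k) '' (K ∩ (fun p => ∑ k, p.1 k * f (p.2 k)) ⁻¹' Set.Ici c) := by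
    rintro ⟨p, ⟨hpK, hpc⟩, hpx⟩
    have : ∑ k, p.1 k * f (p.2 k) ≤ concaveEnvelope X f x :=
      le_csSup hbdd ⟨p.1, p.2, hpK.1.1, hpK.1.2, fun k => hpK.2 k (Set.mem_univ k), hpx, rfl⟩
    exact absurd (hpc.trans this) (not_le.2 hc)
  filter_upwards [mem_nhdsWithin_of_mem_nhds (hclosed.isOpen_compl.mem_nhds hmem),
    self_mem_nhdsWithin] with z hz hzX
  refine lt_of_le_of_lt (csSup_le (combinationValues_nonempty f hzX) ?_) hcy
  rintro _ ⟨lam, xs, h0, h1, hxs, hzx, rfl⟩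
  by_contra! hlt
  exact hz ⟨(lam, xs), ⟨⟨⟨h0, h1⟩, fun k _ => hxs k⟩, hlt.le⟩, hzx⟩

theorem concaveEnvelope_nonneg {n : ℕ} {X : Set (Fin n → ℝ)} {f : (Fin n → ℝ) → ℝ}
    (hf : ∀ x ∈ X, 0 ≤ f x) (x : Fin n → ℝ) : 0 ≤ concaveEnvelope X f x := by
  refine Real.sSup_nonneg ?_
  rintro _ ⟨lam, xs, h0, -, hX, -, rfl⟩
  exact sum_nonneg fun k _ => mul_nonneg (h0 k) (hf _ (hX k))

theorem sqrt_concaveEnvelope_sq_concave_usc_majorizes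
    {n : ℕ} (X : Set (Fin n → ℝ)) (hX : IsCompact X)
    (f : (Fin n → ℝ) → ℝ) (hf : UpperSemicontinuousOn f X)
    (hf0 : ∀ x ∈ X, 0 ≤ f x)
    (q : (Fin n → ℝ) → ℝ) (hq : ∀ x ∈ X, q x = f x ^ 2) :
    ConcaveOn ℝ (convexHull ℝ X) (fun x => Real.sqrt (concaveEnvelope X q x)) ∧
    UpperSemicontinuousOn (fun x => Real.sqrt (concaveEnvelope X q x)) (convexHull ℝ X) ∧
    ∀ x ∈ convexHull ℝ X, concaveEnvelope X f x ≤ Real.sqrt (concaveEnvelope X q x) := by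
  have hq0 : ∀ x ∈ X, 0 ≤ q x := fun x hx => hq x hx ▸ sq_nonneg _
  have hqusc : UpperSemicontinuousOn q X := by
    intro x hx y hy
    rw [hq x hx] at hy
    filter_upwards [hf.sq hf0 x hx y hy, self_mem_nhdsWithin] with z hz hzX
    rwa [hq z hzX]
  have hbdd := hqusc.bddAbove_of_isCompact hX
  refine ⟨⟨convex_convexHull ℝ X, fun x hx y hy a b ha hb hab => ?_⟩, ?_, fun x hx => ?_⟩
  · exact (Real.strictConcaveOn_sqrt.concaveOn.2 (concaveEnvelope_nonneg hq0 x)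
      (concaveEnvelope_nonneg hq0 y) ha hb hab).trans
      (Real.sqrt_le_sqrt ((concaveOn_concaveEnvelope hbdd).2 hx hy ha hb hab))
  · exact Real.continuous_sqrt.comp_upperSemicontinuousOn
      (upperSemicontinuousOn_concaveEnvelope hX hqusc) (fun _ _ h => Real.sqrt_le_sqrt h)
  · refine Real.sSup_le ?_ (Real.sqrt_nonneg _)
    rintro _ ⟨lam, xs, h0, h1, hxs, hx', rfl⟩
    have hsq : (∑ k, lam k * f (xs k)) ^ 2 ≤ ∑ k, lam k * q (xs k) := by
      simpa only [hq _ (hxs _)] using Real.pow_arith_mean_le_arith_mean_pow_of_even univ lam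
        (fun k => f (xs k)) (fun k _ => h0 k) h1 even_two
    exact Real.le_sqrt_of_sq_le (hsq.trans (le_csSup (bddAbove_combinationValues hbdd x)
      ⟨lam, xs, h0, h1, hxs, hx', rfl⟩))
end

section
/- Let 0 ≤ L ≤ U be real numbers with L + U > 0, let K ∈ ℕ, let λ₁, …, λ_K ≥ 0 satisfy λ₁ + ⋯ + λ_K = 1, and let t₁, …, t_K be real numbers with L ≤ t_k ≤ U for all k. Then √(Σ_{k=1}^K λ_k t_k²) − Σ_{k=1}^K λ_k t_k ≤ (U − L)² / (4(L + U)). -/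
open Finset

theorem sqrt_avg_sq_sub_avg_le
    (L U : ℝ) (hL : 0 ≤ L) (hLU : L ≤ U) (hpos : 0 < L + U)
    (K : ℕ) (lam : Fin K → ℝ) (hlam : ∀ k, 0 ≤ lam k) (hsum : ∑ k, lam k = 1)
    (t : Fin K → ℝ) (ht : ∀ k, L ≤ t k ∧ t k ≤ U) :
    Real.sqrt (∑ k, lam k * t k ^ 2) - ∑ k, lam k * t k
      ≤ (U - L) ^ 2 / (4 * (L + U)) := by
  have hQ0 : 0 ≤ ∑ k, lam k * t k ^ 2 :=
    sum_nonneg fun k _ => mul_nonneg (hlam k) (sq_nonneg _)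
  have hQ : ∑ k, lam k * t k ^ 2 ≤ (L + U) * ∑ k, lam k * t k - L * U := by
    calc ∑ k, lam k * t k ^ 2
        ≤ ∑ k, ((L + U) * (lam k * t k) - lam k * (L * U)) := by
          refine sum_le_sum fun k _ => ?_
          have h := mul_nonneg (hlam k)
            (mul_nonneg (sub_nonneg.2 (ht k).1) (sub_nonneg.2 (ht k).2))
          linarith
      _ = (L + U) * ∑ k, lam k * t k - L * U := by
          rw [sum_sub_distrib, ← mul_sum, ← sum_mul, hsum, one_mul]
  have hs := Real.sq_sqrt hQ0
  rw [le_div_iff₀ (by positivity)]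
  nlinarith [sq_nonneg (2 * Real.sqrt (∑ k, lam k * t k ^ 2) - (L + U))]
end

section
/- Let 0 ≤ L ≤ U be real numbers with L + U > 0, and let μ ∈ [L, U]. Then √((U − μ)(μ − L) + μ²) ≤ μ + (U − L)² / (4(L + U)). -/
theorem sqrt_bhatia_davis_bound
    (L U : ℝ) (hL : 0 ≤ L) (hLU : L ≤ U) (hpos : 0 < L + U)
    (μ : ℝ) (hμ : μ ∈ Set.Icc L U) :
    Real.sqrt ((U - μ) * (μ - L) + μ ^ 2) ≤ μ + (U - L) ^ 2 / (4 * (L + U)) := by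
  have hμ_nonneg : 0 ≤ μ := hL.trans hμ.1
  refine Real.sqrt_le_iff.mpr ⟨by positivity, ?_⟩
  have key : (μ + (U - L) ^ 2 / (4 * (L + U))) ^ 2 - ((U - μ) * (μ - L) + μ ^ 2)
      = (μ + (U - L) ^ 2 / (4 * (L + U)) - (L + U) / 2) ^ 2 := by
    field_simp
    ring
  linarith [sq_nonneg (μ + (U - L) ^ 2 / (4 * (L + U)) - (L + U) / 2)]
end

section
/- Let B be a real p×m matrix, let Ā and A⊥ be real p×n matrices, and let d̄, d⊥ ∈ ℝᵖ. Suppose every column of Ā and the vector d̄ lie in the column space of B, while every column of A⊥ and the vector d⊥ are orthogonal to the column space of B. Then for every x ∈ ℝⁿ, y ∈ ℝᵐ, and real t ≥ 0, the inequality ‖(Ā + A⊥)x + By + (d̄ + d⊥)‖₂ ≤ t holds if and only if ‖Āx + By + d̄‖₂² + ‖A⊥x + d⊥‖₂² ≤ t². -/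
open Finset Matrix

theorem euclNorm_sq {p : ℕ} (v : Fin p → ℝ) : euclNorm v ^ 2 = v ⬝ᵥ v := by
  rw [euclNorm, Real.sq_sqrt (Finset.sum_nonneg fun i _ => sq_nonneg (v i))]
  simp only [dotProduct, sq]

theorem euclNorm_add_sq_of_dotProduct_eq_zero {p : ℕ} {u w : Fin p → ℝ} (h : w ⬝ᵥ u = 0) :
    euclNorm (u + w) ^ 2 = euclNorm u ^ 2 + euclNorm w ^ 2 := by
  simp only [euclNorm_sq, add_dotProduct, dotProduct_add, h, dotProduct_comm u w]
  ring

theorem mulVec_mem_of_forall_col_mem {m n R : Type*} [Fintype n] [CommSemiring R]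
    {S : Submodule R (m → R)} {A : Matrix m n R} (h : ∀ j, (fun i => A i j) ∈ S) (x : n → R) :
    A *ᵥ x ∈ S := by
  have hsum : A *ᵥ x = ∑ j, x j • fun i => A i j := by
    ext i
    simp [mulVec, dotProduct, mul_comm]
  rw [hsum]
  exact S.sum_mem fun j _ => S.smul_mem _ (h j)

theorem orthogonal_decomposition_soc
    {n m p : ℕ} (B : Matrix (Fin p) (Fin m) ℝ)
    (Abar Aperp : Matrix (Fin p) (Fin n) ℝ) (dbar dperp : Fin p → ℝ)
    -- columns of Ā and d̄ lie in the column space of B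
    (hAbar : ∀ j : Fin n, (fun i => Abar i j) ∈ LinearMap.range B.mulVecLin)
    (hdbar : dbar ∈ LinearMap.range B.mulVecLin)
    -- columns of A⊥ and d⊥ are orthogonal to every column of B
    (hAperp : ∀ (j : Fin n) (l : Fin m), ∑ i, Aperp i j * B i l = 0)
    (hdperp : ∀ l : Fin m, ∑ i, dperp i * B i l = 0) :
    ∀ (x : Fin n → ℝ) (y : Fin m → ℝ) (t : ℝ), 0 ≤ t →
      (euclNorm ((Abar + Aperp).mulVec x + B.mulVec y + (dbar + dperp)) ≤ t
        ↔ euclNorm (Abar.mulVec x + B.mulVec y + dbar) ^ 2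
            + euclNorm (Aperp.mulVec x + dperp) ^ 2 ≤ t ^ 2) := by
  intro x y t ht
  have hu : Abar *ᵥ x + B *ᵥ y + dbar ∈ LinearMap.range B.mulVecLin :=
    add_mem (add_mem (mulVec_mem_of_forall_col_mem hAbar x) ⟨y, rfl⟩) hdbar
  have hA : Aperpᵀ * B = 0 := by
    ext j l
    exact hAperp j l
  have hd : dperp ᵥ* B = 0 := funext hdperp
  have hw : (Aperp *ᵥ x + dperp) ᵥ* B = 0 := by
    rw [add_vecMul, hd, add_zero, ← vecMul_transpose, vecMul_vecMul, hA, vecMul_zero]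
  have horth : (Aperp *ᵥ x + dperp) ⬝ᵥ (Abar *ᵥ x + B *ᵥ y + dbar) = 0 := by
    obtain ⟨z, hz⟩ := hu
    rw [← hz, mulVecLin_apply, dotProduct_mulVec, hw, zero_dotProduct]
  have hsplit : (Abar + Aperp) *ᵥ x + B *ᵥ y + (dbar + dperp)
      = (Abar *ᵥ x + B *ᵥ y + dbar) + (Aperp *ᵥ x + dperp) := by
    rw [add_mulVec]
    abel
  rw [hsplit, ← euclNorm_add_sq_of_dotProduct_eq_zero horth]
  exact (sq_le_sq₀ (Real.sqrt_nonneg _) ht).symm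
end

section
/- Let Σ be a real symmetric positive semidefinite n×n matrix, μ ∈ ℝⁿ, c ∈ ℝ, and α̃ > 0. Then for every z ∈ ℝⁿ, the inequality μᵀz + √(α̃)·√(zᵀΣz) ≤ c holds if and only if both zᵀ(α̃Σ − μμᵀ)z + 2c·μᵀz ≤ c² and μᵀz ≤ c hold. -/
open Finset Matrix

theorem dotProduct_smul_sub_vecMulVec_mulVec {ι R : Type*} [Fintype ι] [CommRing R]
    (S : Matrix ι ι R) (μ z : ι → R) (α : R) :
    z ⬝ᵥ ((α • S - vecMulVec μ μ).mulVec z) = α * (z ⬝ᵥ S.mulVec z) - (μ ⬝ᵥ z) ^ 2 := by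
  rw [sub_mulVec, smul_mulVec, dotProduct_sub, dotProduct_smul, vecMulVec_mulVec,
    dotProduct_smul, dotProduct_comm z μ]
  simp [sq]

theorem drcc_soc_reformulation
    {n : ℕ} (S : Matrix (Fin n) (Fin n) ℝ) (hS : S.PosSemidef)
    (μ : Fin n → ℝ) (c : ℝ) (α : ℝ) (hα : 0 < α) :
    ∀ z : Fin n → ℝ,
      μ ⬝ᵥ z + Real.sqrt α * Real.sqrt (z ⬝ᵥ S.mulVec z) ≤ c
        ↔ (z ⬝ᵥ ((α • S - vecMulVec μ μ).mulVec z) + 2 * c * (μ ⬝ᵥ z) ≤ c ^ 2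
            ∧ μ ⬝ᵥ z ≤ c) := by
  intro z
  have hq : 0 ≤ z ⬝ᵥ S.mulVec z := by simpa using hS.dotProduct_mulVec_nonneg z
  rw [dotProduct_smul_sub_vecMulVec_mulVec, ← Real.sqrt_mul hα.le, ← le_sub_iff_add_le',
    Real.sqrt_le_iff, sub_nonneg, and_comm]
  refine and_congr_left fun _ => ?_
  constructor <;> intro h <;> linarith [sub_sq c (μ ⬝ᵥ z)]
end
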